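/- arXiv:2211.06384 — 8 statements merged into one kernel-verified Lean document; each statement's English description precedes it below -/
import Mathlib

section
/- Every concise rank-3 tensor in ℂ³⊗ℂ³⊗ℂ³ is identifiable, i.e., it admits exactly one decomposition as a sum of 3 elementary tensors up to permutation of the summands. -/
open scoped BigOperators

/-- A tensor `T ∈ ℂ^a ⊗ ℂ^b ⊗ ℂ^c` (in coordinates) is elementary if it is
`u ⊗ v ⊗ w` for some vectors `u, v, w`. -/
def Elementary3 {a b c : ℕ} (T : Fin a → Fin b → Fin c → ℂ) : Prop :=
  ∃ (u : Fin a → ℂ) (v : Fin b → ℂ) (w : Fin c → ℂ),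
    T = fun i j k => u i * v j * w k

/-- The rank of a tensor: the minimal number of elementary tensors summing to it. -/
noncomputable def rank3 {a b c : ℕ} (T : Fin a → Fin b → Fin c → ℂ) : ℕ :=
  sInf {r | ∃ t : Fin r → (Fin a → Fin b → Fin c → ℂ),
    (∀ s, Elementary3 (t s)) ∧ T = ∑ s, t s}

/-- A tensor is concise if each of its flattenings has maximal rank, i.e. the
slices along each mode span the corresponding factor. -/
def Concise3 {a b c : ℕ} (T : Fin a → Fin b → Fin c → ℂ) : Prop :=
  Submodule.span ℂ {x : Fin a → ℂ | ∃ j k, x = fun i => T i j k} = ⊤ ∧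
  Submodule.span ℂ {x : Fin b → ℂ | ∃ i k, x = fun j => T i j k} = ⊤ ∧
  Submodule.span ℂ {x : Fin c → ℂ | ∃ i j, x = fun k => T i j k} = ⊤

section TripleSums

variable {K ι α β γ : Type*} [Field K] [Fintype ι]

/-- Contracting the first and third factors of an equality between sums of elementary
tensors with linear functionals. -/
theorem contract_first_third {u u' : ι → α → K} {v v' : ι → β → K} {w w' : ι → γ → K}
    (h : ∀ i j k, ∑ s, u s i * v s j * w s k = ∑ s, u' s i * v' s j * w' s k)
    (φ : (α → K) →ₗ[K] K) (ψ : (γ → K) →ₗ[K] K) :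
    ∑ s, (φ (u s) * ψ (w s)) • v s = ∑ s, (φ (u' s) * ψ (w' s)) • v' s := by
  have h₁ : ∀ j k, ∑ s, (v s j * w s k) * φ (u s) = ∑ s, (v' s j * w' s k) * φ (u' s) := by
    intro j k
    have : ∑ s, (v s j * w s k) • u s = ∑ s, (v' s j * w' s k) • u' s := by
      ext i
      simpa [Finset.sum_apply, mul_comm, mul_left_comm, mul_assoc] using h i j k
    simpa using congrArg φ this
  ext j
  have h₂ : ∑ s, (v s j * φ (u s)) • w s = ∑ s, (v' s j * φ (u' s)) • w' s := by
    ext k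
    simpa [Finset.sum_apply, mul_comm, mul_left_comm, mul_assoc] using h₁ j k
  simpa [Finset.sum_apply, mul_comm, mul_left_comm, mul_assoc] using congrArg ψ h₂

theorem coord_mul_coord_eq_zero (u : Module.Basis ι K (α → K)) (w : Module.Basis ι K (γ → K))
    {v v' : ι → β → K} {u' : ι → α → K} {w' : ι → γ → K} (hv' : LinearIndependent K v')
    (h : ∀ i j k, ∑ s, u s i * v s j * w s k = ∑ s, u' s i * v' s j * w' s k)
    {a c : ι} (hac : a ≠ c) (s : ι) : u.coord a (u' s) * w.coord c (w' s) = 0 := by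
  classical
  have hsum := contract_first_third h (u.coord a) (w.coord c)
  have hzero : ∑ s, (u.coord a (u s) * w.coord c (w s)) • v s = 0 := by
    refine Finset.sum_eq_zero fun x _ => ?_
    by_cases hx : x = a
    · subst hx
      simp [hac]
    · simp [Finsupp.single_apply, hx]
  exact Fintype.linearIndependent_iff.mp hv' _ (hsum.symm.trans hzero) s

theorem sum_coord_mul_coord_smul (u : Module.Basis ι K (α → K)) (w : Module.Basis ι K (γ → K))
    {v v' : ι → β → K} {u' : ι → α → K} {w' : ι → γ → K}
    (h : ∀ i j k, ∑ s, u s i * v s j * w s k = ∑ s, u' s i * v' s j * w' s k) (a : ι) :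
    ∑ s, (u.coord a (u' s) * w.coord a (w' s)) • v' s = v a := by
  classical
  rw [← contract_first_third h, Finset.sum_eq_single a]
  · simp
  · intro s _ hs
    simp [hs]
  · simp

theorem eq_coord_smul (u : Module.Basis ι K (α → K)) {x : α → K} {c : ι}
    (h : ∀ a, a ≠ c → u.coord a x = 0) : x = u.coord c x • u c := by
  conv_lhs => rw [← u.sum_repr x]
  exact Finset.sum_eq_single c (fun a _ ha => by rw [← u.coord_apply, h a ha, zero_smul]) (by simp)

/-- Uniqueness of a decomposition into elementary tensors whose factors form bases. -/
theorem exists_perm_of_basis (u u' : Module.Basis ι K (α → K)) (v v' : Module.Basis ι K (β → K))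
    (w w' : Module.Basis ι K (γ → K))
    (h : ∀ i j k, ∑ s, u s i * v s j * w s k = ∑ s, u' s i * v' s j * w' s k) :
    ∃ σ : Equiv.Perm ι, ∀ s i j k,
      u' s i * v' s j * w' s k = u (σ s) i * v (σ s) j * w (σ s) k := by
  classical
  have huw := fun s a c (hac : a ≠ c) => coord_mul_coord_eq_zero u w v'.linearIndependent h hac s
  have h_swap : ∀ j i k, ∑ s, v s j * u s i * w s k = ∑ s, v' s j * u' s i * w' s k := by
    intro j i k
    simpa only [mul_comm (v _ j), mul_comm (v' _ j)] using h i j k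
  have hvw := fun s b c (hbc : b ≠ c) =>
    coord_mul_coord_eq_zero v w u'.linearIndependent h_swap hbc s
  have hne : ∀ s, ∃ c, w.coord c (w' s) ≠ 0 := by
    intro s
    by_contra! hall
    exact w'.ne_zero s (w.forall_coord_eq_zero_iff.mp hall)
  choose σ hσ using hne
  have hu : ∀ s a, a ≠ σ s → u.coord a (u' s) = 0 := fun s a ha =>
    (mul_eq_zero.mp (huw s a _ ha)).resolve_right (hσ s)
  have hv : ∀ s b, b ≠ σ s → v.coord b (v' s) = 0 := fun s b hb =>
    (mul_eq_zero.mp (hvw s b _ hb)).resolve_right (hσ s)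
  have hu' := fun s => eq_coord_smul u (hu s)
  have hv' := fun s => eq_coord_smul v (hv s)
  have hw' : ∀ s, w' s = w.coord (σ s) (w' s) • w (σ s) := by
    intro s
    refine eq_coord_smul w fun c hc => (mul_eq_zero.mp (huw s _ c hc.symm)).resolve_left ?_
    intro h0
    exact u'.ne_zero s (by rw [hu' s, h0, zero_smul])
  have hsurj : Function.Surjective σ := by
    intro a
    by_contra! hall
    refine v.ne_zero a ?_
    rw [← sum_coord_mul_coord_smul u w h a]
    exact Finset.sum_eq_zero fun s _ => by rw [hu s a (hall s).symm, zero_mul, zero_smul]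
  have hbij : Function.Bijective σ := Finite.surjective_iff_bijective.mp hsurj
  refine ⟨Equiv.ofBijective σ hbij, fun s i j k => ?_⟩
  have hscale : (u.coord (σ s) (u' s) * w.coord (σ s) (w' s)) • v' s = v (σ s) := by
    rw [← sum_coord_mul_coord_smul u w h (σ s), Finset.sum_eq_single s]
    · intro x _ hx
      rw [hu x _ fun e => hx (hbij.1 e.symm), zero_mul, zero_smul]
    · simp
  have hj := congrFun hscale j
  have hi := congrFun (hu' s) i
  have hk := congrFun (hw' s) k
  simp only [Pi.smul_apply, smul_eq_mul] at hi hj hk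
  rw [Equiv.ofBijective_apply, hi, hk, ← hj]
  ring

end TripleSums

/-- Vectors of the right number whose span contains a spanning set form a basis. -/
theorem exists_basis_of_span_eq_top {n : ℕ} (u : Fin n → Fin n → ℂ) {S : Set (Fin n → ℂ)}
    (hS : Submodule.span ℂ S = ⊤) (h : ∀ x ∈ S, ∃ c : Fin n → ℂ, x = ∑ s, c s • u s) :
    ∃ b : Module.Basis (Fin n) ℂ (Fin n → ℂ), ⇑b = u := by
  have htop : ⊤ ≤ Submodule.span ℂ (Set.range u) := by
    rw [← hS, Submodule.span_le]
    intro x hx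
    obtain ⟨c, rfl⟩ := h x hx
    exact Submodule.sum_mem _ fun s _ =>
      Submodule.smul_mem _ _ (Submodule.subset_span (Set.mem_range_self s))
  have hli := linearIndependent_of_top_le_span_of_card_eq_finrank htop (by simp)
  exact ⟨Module.Basis.mk hli htop, Module.Basis.coe_mk hli htop⟩

/-- The factors of a decomposition of a concise `n × n × n` tensor into `n` elementary tensors
form bases. -/
theorem Concise3.exists_bases {n : ℕ} {T : Fin n → Fin n → Fin n → ℂ} (hT : Concise3 T)
    {t : Fin n → Fin n → Fin n → Fin n → ℂ} (ht : ∀ s, Elementary3 (t s)) (hsum : T = ∑ s, t s) :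
    ∃ u v w : Module.Basis (Fin n) ℂ (Fin n → ℂ),
      ∀ s, t s = fun i j k => u s i * v s j * w s k := by
  choose u v w huvw using ht
  have hT' : ∀ i j k, T i j k = ∑ s, u s i * v s j * w s k := by
    intro i j k
    simp only [hsum, Finset.sum_apply, huvw]
  obtain ⟨bu, rfl⟩ := exists_basis_of_span_eq_top u hT.1 <| by
    rintro _ ⟨j, k, rfl⟩
    refine ⟨fun s => v s j * w s k, funext fun i => ?_⟩
    simp [hT', mul_comm, mul_left_comm]
  obtain ⟨bv, rfl⟩ := exists_basis_of_span_eq_top v hT.2.1 <| by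
    rintro _ ⟨i, k, rfl⟩
    refine ⟨fun s => bu s i * w s k, funext fun j => ?_⟩
    simp [hT', mul_comm, mul_left_comm]
  obtain ⟨bw, rfl⟩ := exists_basis_of_span_eq_top w hT.2.2 <| by
    rintro _ ⟨i, j, rfl⟩
    refine ⟨fun s => bu s i * bv s j, funext fun k => ?_⟩
    simp [hT']
  exact ⟨bu, bv, bw, huvw⟩

/-- Every concise rank-3 tensor in `ℂ³⊗ℂ³⊗ℂ³` is identifiable: it admits exactly one
decomposition as a sum of 3 elementary tensors, up to permutation of the summands. -/
theorem stmt0 (T : Fin 3 → Fin 3 → Fin 3 → ℂ)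
    (hconc : Concise3 T) (hrk : rank3 T = 3) :
    (∃ t : Fin 3 → (Fin 3 → Fin 3 → Fin 3 → ℂ),
      (∀ s, Elementary3 (t s)) ∧ T = ∑ s, t s) ∧
    ∀ t t' : Fin 3 → (Fin 3 → Fin 3 → Fin 3 → ℂ),
      (∀ s, Elementary3 (t s)) → (∀ s, Elementary3 (t' s)) →
      T = ∑ s, t s → T = ∑ s, t' s →
      ∃ σ : Equiv.Perm (Fin 3), ∀ s, t' s = t (σ s) := by
  constructor
  · have hmem := Nat.sInf_mem (Nat.nonempty_of_sInf_eq_succ hrk)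
    rw [← rank3, hrk] at hmem
    exact hmem
  · intro t t' ht ht' hsum hsum'
    obtain ⟨u, v, w, huvw⟩ := hconc.exists_bases ht hsum
    obtain ⟨u', v', w', huvw'⟩ := hconc.exists_bases ht' hsum'
    obtain ⟨σ, hσ⟩ := exists_perm_of_basis u u' v v' w w' fun i j k => by
      have h := congrFun (congrFun (congrFun (hsum.symm.trans hsum') i) j) k
      simpa only [Finset.sum_apply, huvw, huvw'] using h
    refine ⟨σ, fun s => ?_⟩
    rw [huvw', huvw]
    ext i j k
    exact hσ s i j k
end

section
/- Let k ≥ 3 and let T ∈ ℂ^{n₁}⊗⋯⊗ℂ^{n_k} be a concise rank-3 tensor such that at least three of the dimensions n₁,…,n_k are equal to 3. Then T is identifiable. -/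
open scoped BigOperators

/-- A coordinate tensor `T ∈ ℂ^{n 0} ⊗ ⋯ ⊗ ℂ^{n (k-1)}` is elementary if it is
`v₁ ⊗ ⋯ ⊗ v_k` for some vectors `v i`. -/
def ElementaryT {k : ℕ} {n : Fin k → ℕ} (T : (∀ i, Fin (n i)) → ℂ) : Prop :=
  ∃ v : ∀ i, Fin (n i) → ℂ, T = fun j => ∏ i, v i (j i)

/-- The rank of a tensor: the minimal number of elementary tensors summing to it. -/
noncomputable def rankT {k : ℕ} {n : Fin k → ℕ} (T : (∀ i, Fin (n i)) → ℂ) : ℕ :=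
  sInf {r | ∃ t : Fin r → ((∀ i, Fin (n i)) → ℂ),
    (∀ s, ElementaryT (t s)) ∧ T = ∑ s, t s}

/-- A tensor is concise if for every factor `i` the slices along mode `i`
span all of `ℂ^{n i}` (i.e. every flattening has maximal rank). -/
def ConciseT {k : ℕ} {n : Fin k → ℕ} (T : (∀ i, Fin (n i)) → ℂ) : Prop :=
  ∀ i, Submodule.span ℂ
    {w : Fin (n i) → ℂ | ∃ j : ∀ i', Fin (n i'),
      w = fun b => T (Function.update j i b)} = ⊤

section Bilinear

variable {ι X Y Z : Type*} [Fintype ι]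

/-- If a combination `∑ s, b s ⊗ f s`, with `b` independent, equals `∑ s, b s ⊗ g s`, then
`f = g`. -/
lemma eq_of_sum_mul_eq_of_linearIndependent {b : ι → Y → ℂ} (hb : LinearIndependent ℂ b)
    {f g : ι → ℂ} (h : ∀ y, ∑ s, f s * b s y = ∑ s, g s * b s y) (s : ι) : f s = g s := by
  rw [Fintype.linearIndependent_iff] at hb
  refine sub_eq_zero.mp (hb (fun s => f s - g s) ?_ s)
  ext y
  simp [sub_mul, h y]

/-- Uniqueness of the decomposition of a three-factor tensor whose factors are independent. -/
theorem exists_perm_of_sum_mul_mul_eq (a a' : ι → X → ℂ) (b b' : ι → Y → ℂ) (e e' : ι → Z → ℂ)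
    (ha : ∀ s, a s ≠ 0) (ha' : LinearIndependent ℂ a')
    (ha'_span : Submodule.span ℂ (Set.range a') = ⊤)
    (hb : LinearIndependent ℂ b) (hb_span : Submodule.span ℂ (Set.range b) = ⊤)
    (he : LinearIndependent ℂ e)
    (h : ∀ x y z, ∑ s, a s x * b s y * e s z = ∑ s, a' s x * b' s y * e' s z) :
    ∃ σ : Equiv.Perm ι, ∀ s x y z,
      a' s x * b' s y * e' s z = a (σ s) x * b (σ s) y * e (σ s) z := by
  classical
  have expand_a : ∀ s, ∃ M : ι → ℂ, ∑ u, M u • a' u = a s := fun s =>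
    (Submodule.mem_span_range_iff_exists_fun ℂ).mp (ha'_span ▸ Submodule.mem_top)
  have expand_b' : ∀ s, ∃ N : ι → ℂ, ∑ u, N u • b u = b' s := fun s =>
    (Submodule.mem_span_range_iff_exists_fun ℂ).mp (hb_span ▸ Submodule.mem_top)
  choose M hM using expand_a
  choose N hN using expand_b'
  have slice : ∀ u y z, ∑ s, M s u * b s y * e s z = b' u y * e' u z := by
    intro u y z
    refine eq_of_sum_mul_eq_of_linearIndependent ha' (f := fun u => ∑ s, M s u * b s y * e s z)
      (g := fun u => b' u y * e' u z) (fun x => ?_) u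
    have hx := h x y z
    simp only [← hM, Finset.sum_apply, Pi.smul_apply, smul_eq_mul, Finset.sum_mul] at hx
    rw [Finset.sum_comm] at hx
    simp only [Finset.sum_mul]
    refine Eq.trans (Finset.sum_congr rfl fun u _ => Finset.sum_congr rfl fun s _ => ?_)
      (hx.trans (Finset.sum_congr rfl fun u _ => ?_)) <;> ring
  have coeff : ∀ u s z, M s u * e s z = N u s * e' u z := by
    intro u s z
    refine eq_of_sum_mul_eq_of_linearIndependent hb (f := fun s => M s u * e s z)
      (g := fun s => N u s * e' u z) (fun y => ?_) s
    have hy := slice u y z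
    simp only [← hN, Finset.sum_apply, Pi.smul_apply, smul_eq_mul, Finset.sum_mul] at hy
    convert hy using 2 <;> ring
  have column : ∀ u s s', M s u ≠ 0 → M s' u ≠ 0 → s = s' := by
    intro u s s' hs hs'
    by_contra hne
    have hN0 : N u s = 0 := by
      have := eq_of_sum_mul_eq_of_linearIndependent he
        (f := Pi.single s' (N u s * M s' u)) (g := Pi.single s (N u s' * M s u))
        (fun z => by
          simp only [Pi.single_apply, ite_mul, zero_mul, Finset.sum_ite_eq', Finset.mem_univ,
            if_true]
          linear_combination N u s * coeff u s' z - N u s' * coeff u s z) s'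
      simpa [Pi.single_apply, Ne.symm hne, hs'] using this
    refine he.ne_zero s (funext fun z => ?_)
    simpa [hN0, hs] using coeff u s z
  have row : ∀ s, ∃ u, M s u ≠ 0 := by
    intro s
    by_contra! h0
    exact ha s (by simp [← hM, h0])
  choose τ hτ using row
  have hinj : Function.Injective τ := fun s s' hss => column (τ s) s s' (hτ s) (hss ▸ hτ s')
  have hbij : Function.Bijective τ := Finite.injective_iff_bijective.mp hinj
  have hzero : ∀ s s', s' ≠ s → M s' (τ s) = 0 := fun s s' hne => by
    by_contra h0
    exact hne (column _ _ _ h0 (hτ s))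
  have ha_eq : ∀ s x, a s x = M s (τ s) * a' (τ s) x := by
    intro s x
    rw [← hM s, Finset.sum_apply, Finset.sum_eq_single (τ s)]
    · rfl
    · intro u _ hu
      obtain ⟨s', rfl⟩ := hbij.2 u
      simp [hzero s' s (fun h => hu (h ▸ rfl))]
    · simp
  have hbe_eq : ∀ s y z, M s (τ s) * b s y * e s z = b' (τ s) y * e' (τ s) z := by
    intro s y z
    rw [← slice, Finset.sum_eq_single s]
    · intro s' _ hs'
      simp [hzero s s' hs']
    · simp
  let τe := Equiv.ofBijective τ hbij
  refine ⟨τe.symm, fun u x y z => ?_⟩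
  obtain ⟨s, rfl⟩ := τe.surjective u
  rw [Equiv.symm_apply_apply, ha_eq]
  change a' (τ s) x * b' (τ s) y * e' (τ s) z = _
  linear_combination (-a' (τ s) x) * hbe_eq s y z

end Bilinear

section Concise

variable {k : ℕ} {n : Fin k → ℕ}

/-- The mode-`p` factors of a decomposition of a concise tensor span the whole space. -/
lemma ConciseT.span_factors_eq_top {ι : Type*} [Fintype ι] {T : (∀ i, Fin (n i)) → ℂ}
    (hT : ConciseT T) (v : ι → ∀ i, Fin (n i) → ℂ)
    (h : T = ∑ s, fun j : ∀ i, Fin (n i) => ∏ i, v s i (j i)) (p : Fin k) :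
    Submodule.span ℂ (Set.range fun s => v s p) = ⊤ := by
  rw [eq_top_iff, ← hT p, Submodule.span_le]
  rintro w ⟨j, rfl⟩
  refine (Submodule.mem_span_range_iff_exists_fun ℂ).mpr
    ⟨fun s => ∏ i ∈ Finset.univ.erase p, v s i (j i), ?_⟩
  ext x
  simp only [h, Finset.sum_apply, Pi.smul_apply, smul_eq_mul]
  refine Finset.sum_congr rfl fun s _ => ?_
  rw [← Finset.prod_erase_mul _ _ (Finset.mem_univ p), Function.update_self]
  congr 1
  refine Finset.prod_congr rfl fun i hi => ?_
  rw [Function.update_of_ne (Finset.ne_of_mem_erase hi)]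

/-- No summand vanishes in a decomposition whose length is the rank. -/
lemma ne_zero_of_rankT_eq_succ {r : ℕ} {T : (∀ i, Fin (n i)) → ℂ} (hT : rankT T = r + 1)
    (t : Fin (r + 1) → ((∀ i, Fin (n i)) → ℂ)) (ht : ∀ s, ElementaryT (t s))
    (h : T = ∑ s, t s) (s : Fin (r + 1)) : t s ≠ 0 := by
  intro h0
  have : rankT T ≤ r := Nat.sInf_le
    ⟨fun u => t (s.succAbove u), fun u => ht _, by
      rw [h, Fin.sum_univ_succAbove _ s, h0, zero_add]⟩
  omega

lemma linearIndependent_of_span_eq_top_of_card_eq {ι : Type*} [Fintype ι] {m : ℕ}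
    (f : ι → Fin m → ℂ) (hf : Submodule.span ℂ (Set.range f) = ⊤) (hm : m = Fintype.card ι) :
    LinearIndependent ℂ f :=
  linearIndependent_of_top_le_span_of_card_eq_finrank hf.ge (by simp [hm])

/-- The partial products over a set of modes containing `r` are independent as soon as the
mode-`r` factors are and none of the rank-one terms vanishes. -/
lemma linearIndependent_prod {ι : Type*} [Fintype ι] (v : ι → ∀ i, Fin (n i) → ℂ)
    (hv : ∀ s, ∃ j : ∀ i, Fin (n i), ∏ i, v s i (j i) ≠ 0) {r : Fin k}
    (hr : LinearIndependent ℂ fun s => v s r) {S : Finset (Fin k)} (hS : r ∈ S) :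
    LinearIndependent ℂ fun s (j : ∀ i, Fin (n i)) => ∏ i ∈ S, v s i (j i) := by
  rw [Fintype.linearIndependent_iff]
  intro g hg s
  obtain ⟨j, hj⟩ := hv s
  have key := eq_of_sum_mul_eq_of_linearIndependent hr
    (f := fun u => g u * ∏ i ∈ S.erase r, v u i (j i)) (g := 0) (fun x => by
      have hx := congrFun hg (Function.update j r x)
      simp only [Finset.sum_apply, Pi.smul_apply, smul_eq_mul, Pi.zero_apply] at hx
      simp only [Pi.zero_apply, zero_mul, Finset.sum_const_zero]
      rw [← hx]
      refine Finset.sum_congr rfl fun u _ => ?_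
      rw [← Finset.prod_erase_mul _ _ hS, Function.update_self, ← mul_assoc]
      congr 2
      refine Finset.prod_congr rfl fun i hi => ?_
      rw [Function.update_of_ne (Finset.ne_of_mem_erase hi)]) s
  refine (mul_eq_zero.mp key).resolve_right ?_
  exact Finset.prod_ne_zero_iff.mpr fun i _ => Finset.prod_ne_zero_iff.mp hj i (Finset.mem_univ i)

lemma prod_eq_mul_mul_prod_erase_erase (f : Fin k → ℂ) {p q : Fin k} (hpq : p ≠ q) :
    ∏ i, f i = f p * f q * ∏ i ∈ (Finset.univ.erase p).erase q, f i := by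
  rw [← Finset.mul_prod_erase _ _ (Finset.mem_univ p),
    ← Finset.mul_prod_erase (Finset.univ.erase p) f (a := q) (by simp [hpq.symm]), mul_assoc]

lemma prod_update_update (v : ∀ i, Fin (n i) → ℂ) {p q : Fin k} (hpq : p ≠ q)
    (j : ∀ i, Fin (n i)) (x : Fin (n p)) (y : Fin (n q)) :
    ∏ i, v i (Function.update (Function.update j p x) q y i) =
      v p x * v q y * ∏ i ∈ (Finset.univ.erase p).erase q, v i (j i) := by
  rw [prod_eq_mul_mul_prod_erase_erase _ hpq, Function.update_self, Function.update_of_ne hpq,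
    Function.update_self]
  congr 1
  refine Finset.prod_congr rfl fun i hi => ?_
  simp only [Finset.mem_erase] at hi
  rw [Function.update_of_ne hi.1, Function.update_of_ne hi.2.1]

end Concise

/-- If `T` is a concise rank-3 tensor with at least three factors of dimension 3,
then `T` is identifiable. -/
theorem stmt1 {k : ℕ} (hk : 3 ≤ k) (n : Fin k → ℕ)
    (T : (∀ i, Fin (n i)) → ℂ)
    (hconc : ConciseT T) (hrk : rankT T = 3)
    (h3 : 3 ≤ (Finset.univ.filter fun i => n i = 3).card) :
    ∀ t t' : Fin 3 → ((∀ i, Fin (n i)) → ℂ),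
      (∀ s, ElementaryT (t s)) → (∀ s, ElementaryT (t' s)) →
      T = ∑ s, t s → T = ∑ s, t' s →
      ∃ σ : Equiv.Perm (Fin 3), ∀ s, t' s = t (σ s) := by
  intro t t' ht ht' hT hT'
  obtain ⟨p, q, r, hp, hq, hr, hpq, hpr, hqr⟩ := Finset.two_lt_card_iff.mp h3
  simp only [Finset.mem_filter, Finset.mem_univ, true_and] at hp hq hr
  have hne := ne_zero_of_rankT_eq_succ hrk t ht hT
  choose v hv using ht
  choose w hw using ht'
  obtain rfl : t = _ := funext hv
  obtain rfl : t' = _ := funext hw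
  have hspan := hconc.span_factors_eq_top v hT
  have hspan' := hconc.span_factors_eq_top w hT'
  have hli : ∀ i, n i = 3 → LinearIndependent ℂ fun s => v s i := fun i hi =>
    linearIndependent_of_span_eq_top_of_card_eq _ (hspan i) (by simp [hi])
  have hli' := linearIndependent_of_span_eq_top_of_card_eq _ (hspan' p) (by simp [hp])
  obtain ⟨σ, hσ⟩ := exists_perm_of_sum_mul_mul_eq (fun s => v s p) (fun s => w s p)
    (fun s => v s q) (fun s => w s q)
    (fun s (j : ∀ i, Fin (n i)) => ∏ i ∈ (Finset.univ.erase p).erase q, v s i (j i))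
    (fun s (j : ∀ i, Fin (n i)) => ∏ i ∈ (Finset.univ.erase p).erase q, w s i (j i))
    (hli p hp).ne_zero hli' (hspan' p) (hli q hq) (hspan q)
    (linearIndependent_prod v (fun s => Function.ne_iff.mp (hne s)) (hli r hr)
      (by simp [hpr.symm, hqr.symm]))
    (fun x y j => by
      have hj := congrFun (hT.symm.trans hT') (Function.update (Function.update j p x) q y)
      simpa only [Finset.sum_apply, prod_update_update _ hpq] using hj)
  refine ⟨σ, fun s => funext fun j => ?_⟩
  simp only [prod_eq_mul_mul_prod_erase_erase _ hpq]
  exact hσ s (j p) (j q) j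
end

section
/- Every rank-3 tensor T ∈ ℂ²⊗ℂ²⊗ℂ² is not identifiable; in fact T admits infinitely many pairwise inequivalent decompositions as a sum of 3 elementary tensors. -/
open scoped BigOperators

/-- `T` is identifiable with respect to decompositions of length `r`: any two
decompositions of `T` as a sum of `r` elementary tensors agree up to a
permutation of the summands. -/
def IdentifiableWith3 {a b c : ℕ} (T : Fin a → Fin b → Fin c → ℂ) (r : ℕ) : Prop :=
  ∀ t t' : Fin r → (Fin a → Fin b → Fin c → ℂ),
    (∀ s, Elementary3 (t s)) → (∀ s, Elementary3 (t' s)) →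
    T = ∑ s, t s → T = ∑ s, t' s →
    ∃ σ : Equiv.Perm (Fin r), ∀ s, t' s = t (σ s)

/-- A `2 × 2` matrix with zero determinant, tensored with a vector, is an elementary tensor. -/
lemma elementary3_of_det_eq_zero {a : ℕ} (u : Fin a → ℂ) (M : Fin 2 → Fin 2 → ℂ)
    (hM : M 0 0 * M 1 1 = M 0 1 * M 1 0) :
    Elementary3 (fun i j k => u i * M j k) := by
  by_cases h0 : M 0 = 0
  · refine ⟨u, ![0, 1], M 1, ?_⟩
    funext i j k
    fin_cases j <;> simp [h0]
  · obtain ⟨l, hl⟩ := Function.ne_iff.mp h0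
    refine ⟨u, ![1, M 1 l / M 0 l], M 0, ?_⟩
    funext i j k
    rw [Pi.zero_apply] at hl
    fin_cases j
    · simp
    · fin_cases l <;> fin_cases k <;> simp at hl ⊢ <;> field_simp <;> grind

/-- A binary quadratic form over `ℂ` with nonzero discriminant has two independent zeros. -/
lemma exists_independent_zeros_of_discrim_ne_zero (A B C : ℂ) (h : discrim A B C ≠ 0) :
    ∃ x y z w : ℂ, x * w - y * z ≠ 0 ∧
      A * x ^ 2 + B * x * y + C * y ^ 2 = 0 ∧ A * z ^ 2 + B * z * w + C * w ^ 2 = 0 := by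
  rw [discrim] at h
  by_cases hA : A = 0
  · subst hA
    exact ⟨1, 0, -C, B, fun hB => h (by grind), by ring, by ring⟩
  · obtain ⟨d, hd⟩ := IsAlgClosed.exists_pow_nat_eq (B ^ 2 - 4 * A * C) two_pos
    have hd0 : d ≠ 0 := by
      rintro rfl
      exact h (by simpa using hd.symm)
    refine ⟨-B + d, 2 * A, -B - d, 2 * A, ?_, ?_, ?_⟩
    · have : (-B + d) * (2 * A) - 2 * A * (-B - d) = 4 * A * d := by ring
      rw [this]
      simp [hA, hd0]
    · linear_combination A * hd
    · linear_combination A * hd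

/-- Cayley's hyperdeterminant of a `2 × 2 × 2` tensor: the discriminant of the determinant of the
pencil spanned by its two slices. -/
def hyperdet (T : Fin 2 → Fin 2 → Fin 2 → ℂ) : ℂ :=
  discrim (T 0 0 0 * T 0 1 1 - T 0 0 1 * T 0 1 0)
    (T 0 0 0 * T 1 1 1 + T 1 0 0 * T 0 1 1 - T 0 0 1 * T 1 1 0 - T 1 0 1 * T 0 1 0)
    (T 1 0 0 * T 1 1 1 - T 1 0 1 * T 1 1 0)

lemma exists_elementary3_add_of_hyperdet_ne_zero (T : Fin 2 → Fin 2 → Fin 2 → ℂ)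
    (h : hyperdet T ≠ 0) :
    ∃ P Q, Elementary3 P ∧ Elementary3 Q ∧ T = P + Q := by
  obtain ⟨x, y, z, w, hd, hP, hQ⟩ := exists_independent_zeros_of_discrim_ne_zero _ _ _ h
  obtain ⟨c, hc⟩ : ∃ c, c * (x * w - y * z) = 1 := ⟨_, inv_mul_cancel₀ hd⟩
  refine ⟨_, _,
    elementary3_of_det_eq_zero ![w * c, -z * c]
      (fun j k => x * T 0 j k + y * T 1 j k) (by linear_combination hP),
    elementary3_of_det_eq_zero ![-y * c, x * c]
      (fun j k => z * T 0 j k + w * T 1 j k) (by linear_combination hQ), ?_⟩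
  funext i j k
  fin_cases i
  · simp
    linear_combination -T 0 j k * hc
  · simp
    linear_combination -T 1 j k * hc

/-- Elementary tensors are closed under scaling. -/
lemma Elementary3.smul {a b c : ℕ} {E : Fin a → Fin b → Fin c → ℂ} (hE : Elementary3 E) (s : ℂ) :
    Elementary3 (s • E) := by
  obtain ⟨u, v, w, rfl⟩ := hE
  refine ⟨s • u, v, w, ?_⟩
  funext i j k
  simp [mul_assoc]

/-- If the slice `T 1` is nonzero, there is a line through `T` in the direction of an elementary
tensor on which the hyperdeterminant has only finitely many zeros. -/
lemma exists_elementary3_infinite_hyperdet_ne_zero (T : Fin 2 → Fin 2 → Fin 2 → ℂ)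
    (hT : T 1 ≠ 0) :
    ∃ E, Elementary3 E ∧ E ≠ 0 ∧ {s : ℂ | hyperdet (T - s • E) ≠ 0}.Infinite := by
  obtain ⟨j, hj⟩ := Function.ne_iff.mp hT
  obtain ⟨k, hk⟩ := Function.ne_iff.mp hj
  simp only [Pi.zero_apply] at hk
  set E : Fin 2 → Fin 2 → Fin 2 → ℂ := fun a b c =>
    Pi.single (M := fun _ => ℂ) 0 1 a * Pi.single (M := fun _ => ℂ) (j + 1) 1 b *
      Pi.single (M := fun _ => ℂ) (k + 1) 1 c with hE
  have hquad (s : ℂ) : hyperdet (T - s • E) = T 1 j k ^ 2 * s ^ 2 +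
      (hyperdet (T - E) - T 1 j k ^ 2 - hyperdet T) * s + hyperdet T := by
    fin_cases j <;> fin_cases k <;> simp [hE, hyperdet, discrim] <;> ring
  refine ⟨E, ⟨_, _, _, rfl⟩, fun h => ?_, ?_⟩
  · simpa [hE] using congrFun (congrFun (congrFun h 0) (j + 1)) (k + 1)
  · have hfin : {s : ℂ | hyperdet (T - s • E) = 0}.Finite := by
      let p : Polynomial ℂ := .C (T 1 j k ^ 2) * .X ^ 2 +
        .C (hyperdet (T - E) - T 1 j k ^ 2 - hyperdet T) * .X + .C (hyperdet T)
      have hp : p ≠ 0 := fun h0 => pow_ne_zero 2 hk <| by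
        rw [← Polynomial.leadingCoeff_quadratic (pow_ne_zero 2 hk)]
        exact Polynomial.leadingCoeff_eq_zero.mpr h0
      refine (Polynomial.finite_setOfPred_isRoot hp).subset fun s hs => ?_
      simpa [p, hquad] using hs
    exact hfin.infinite_compl

/-- A tensor whose slice `T 1` vanishes has rank at most two. -/
lemma rank3_le_two_of_slice_eq_zero (T : Fin 2 → Fin 2 → Fin 2 → ℂ) (hT : T 1 = 0) :
    rank3 T ≤ 2 := by
  refine Nat.sInf_le ⟨![fun i j k => ![1, 0] i * ![1, 0] j * T 0 0 k,
    fun i j k => ![1, 0] i * ![0, 1] j * T 0 1 k], ?_, ?_⟩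
  · intro s
    fin_cases s
    · exact ⟨_, _, _, rfl⟩
    · exact ⟨_, _, _, rfl⟩
  · funext i j k
    fin_cases i <;> fin_cases j <;> simp [hT]

/-- If `T - s • E` is a sum of two elementary tensors for infinitely many `s`, then `T` has
infinitely many pairwise inequivalent decompositions into three elementary tensors. -/
lemma exists_inequivalent_decompositions {a b c : ℕ} {T E : Fin a → Fin b → Fin c → ℂ}
    (hE : Elementary3 E) (hE0 : E ≠ 0) {S : Set ℂ} (hS : S.Infinite)
    (h : ∀ s ∈ S, ∃ P Q, Elementary3 P ∧ Elementary3 Q ∧ T - s • E = P + Q) :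
    ∃ D : ℕ → (Fin 3 → (Fin a → Fin b → Fin c → ℂ)),
      (∀ m, (∀ s, Elementary3 (D m s)) ∧ T = ∑ s, D m s) ∧
      ∀ m m', m ≠ m' → ¬ ∃ σ : Equiv.Perm (Fin 3), ∀ s, D m' s = D m (σ s) := by
  choose! P Q hP hQ hPQ using h
  let t (s : ℂ) : Fin 3 → (Fin a → Fin b → Fin c → ℂ) := ![s • E, P s, Q s]
  have hinf : ((fun s => Set.range (t s)) '' S).Infinite := fun hfin => by
    refine (hS.image (smul_left_injective ℂ hE0).injOn) ((hfin.sUnion ?_).subset ?_)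
    · rintro _ ⟨s, -, rfl⟩
      exact Set.finite_range _
    · rintro _ ⟨s, hs, rfl⟩
      exact ⟨_, ⟨s, hs, rfl⟩, 0, rfl⟩
  let f := hinf.natEmbedding
  choose g hgS hg using fun m => (f m).2
  refine ⟨fun m => t (g m), fun m => ⟨fun s => ?_, ?_⟩, ?_⟩
  · fin_cases s
    · exact hE.smul _
    · exact hP _ (hgS m)
    · exact hQ _ (hgS m)
  · rw [Fin.sum_univ_three]
    change T = g m • E + P (g m) + Q (g m)
    rw [add_assoc, ← hPQ _ (hgS m), add_sub_cancel]
  · rintro m m' hne ⟨σ, hσ⟩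
    refine hne (f.injective (Subtype.ext ?_))
    rw [← hg m, ← hg m']
    change Set.range (t (g m)) = Set.range (t (g m'))
    rw [← σ.surjective.range_comp (t (g m))]
    exact congrArg Set.range (funext hσ).symm

/-- Every rank-3 tensor in `ℂ²⊗ℂ²⊗ℂ²` is not identifiable; in fact it admits
infinitely many pairwise inequivalent decompositions as sums of 3 elementary
tensors. -/
theorem stmt3 (T : Fin 2 → Fin 2 → Fin 2 → ℂ) (hrk : rank3 T = 3) :
    ¬ IdentifiableWith3 T 3 ∧
    ∃ D : ℕ → (Fin 3 → (Fin 2 → Fin 2 → Fin 2 → ℂ)),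
      (∀ m, (∀ s, Elementary3 (D m s)) ∧ T = ∑ s, D m s) ∧
      ∀ m m', m ≠ m' →
        ¬ ∃ σ : Equiv.Perm (Fin 3), ∀ s, D m' s = D m (σ s) := by
  have hslice : T 1 ≠ 0 := fun h => by
    have := rank3_le_two_of_slice_eq_zero T h
    lia
  obtain ⟨E, hE, hE0, hS⟩ := exists_elementary3_infinite_hyperdet_ne_zero T hslice
  obtain ⟨D, hD, hne⟩ := exists_inequivalent_decompositions hE hE0 hS
    fun s hs => exists_elementary3_add_of_hyperdet_ne_zero _ hs
  exact ⟨fun hid => hne 0 1 zero_ne_one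
    (hid _ _ (hD 0).1 (hD 1).1 (hD 0).2 (hD 1).2), D, hD, hne⟩
end

section
/- Every concise tensor T ∈ ℂ³⊗ℂ²⊗ℂ² is a non-identifiable rank-3 tensor: T has rank 3 and admits infinitely many pairwise inequivalent decompositions as a sum of 3 elementary tensors. -/
open scoped BigOperators

/-- The first flattening bounds the length of any decomposition from below. -/
theorem le_length_of_span_eq_top {a b c r : ℕ} {T : Fin a → Fin b → Fin c → ℂ}
    (h : Submodule.span ℂ {x : Fin a → ℂ | ∃ j k, x = fun i => T i j k} = ⊤)
    {t : Fin r → (Fin a → Fin b → Fin c → ℂ)} (ht : ∀ s, Elementary3 (t s))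
    (hT : T = ∑ s, t s) : a ≤ r := by
  choose u v w huvw using ht
  have htop : Submodule.span ℂ (Set.range u) = ⊤ := by
    rw [eq_top_iff, ← h, Submodule.span_le]
    rintro _ ⟨j, k, rfl⟩
    have hx : (fun i => T i j k) = ∑ s, (v s j * w s k) • u s := by
      funext i
      rw [hT]
      simp only [Finset.sum_apply, Pi.smul_apply, smul_eq_mul]
      refine Finset.sum_congr rfl fun s _ => ?_
      rw [huvw s]
      ring
    rw [hx]
    exact Submodule.sum_mem _ fun s _ =>
      Submodule.smul_mem _ _ (Submodule.subset_span ⟨s, rfl⟩)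
  have hle := finrank_range_le_card (R := ℂ) u
  rw [Set.finrank, htop, finrank_top] at hle
  simpa using hle

/-- A tensor has a sequence of pairwise inequivalent decompositions of length `r`. -/
def HasInequivalentDecompositions {a b c : ℕ} (T : Fin a → Fin b → Fin c → ℂ) (r : ℕ) : Prop :=
  ∃ D : ℕ → (Fin r → (Fin a → Fin b → Fin c → ℂ)),
    (∀ m, (∀ s, Elementary3 (D m s)) ∧ T = ∑ s, D m s) ∧
    ∀ m m', m ≠ m' → ¬ ∃ σ : Equiv.Perm (Fin r), ∀ s, D m' s = D m (σ s)

theorem HasInequivalentDecompositions.of_reindex {a b c r : ℕ} {T : Fin a → Fin b → Fin c → ℂ}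
    (π : Equiv.Perm (Fin b)) (ρ : Equiv.Perm (Fin c))
    (h : HasInequivalentDecompositions (fun i j k => T i (π j) (ρ k)) r) :
    HasInequivalentDecompositions T r := by
  obtain ⟨D, hD, hne⟩ := h
  refine ⟨fun m s i j k => D m s i (π.symm j) (ρ.symm k), fun m => ⟨fun s => ?_, ?_⟩, ?_⟩
  · obtain ⟨u, v, w, h⟩ := (hD m).1 s
    exact ⟨u, v ∘ π.symm, w ∘ ρ.symm, by simp [h]⟩
  · funext i j k
    have h := congrFun (congrFun (congrFun (hD m).2 i) (π.symm j)) (ρ.symm k)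
    simpa [Finset.sum_apply] using h
  · rintro m m' hm ⟨σ, hσ⟩
    refine hne m m' hm ⟨σ, fun s => ?_⟩
    funext i j k
    simpa using congrFun (congrFun (congrFun (hσ s) i) (π j)) (ρ k)

/-- Decompositions of a tensor of `ℂ³ ⊗ ℂ² ⊗ ℂ²` of first multilinear rank `3` are inequivalent
as soon as the slope of the second factor of some summand separates them. -/
theorem hasInequivalentDecompositions_of_slopes {T : Fin 3 → Fin 2 → Fin 2 → ℂ}
    (h : Submodule.span ℂ {x : Fin 3 → ℂ | ∃ j k, x = fun i => T i j k} = ⊤)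
    (u : ℕ → Fin 3 → Fin 3 → ℂ) (t : ℕ → Fin 3 → ℂ) (w : ℕ → Fin 3 → Fin 2 → ℂ)
    (hT : ∀ m, T = ∑ s, fun i j k => u m s i * ![t m s, 1] j * w m s k)
    (ht : ∀ m m' s, m ≠ m' → t m 0 ≠ t m' s) :
    HasInequivalentDecompositions T 3 := by
  have hel : ∀ m s, Elementary3 (fun i j k => u m s i * ![t m s, 1] j * w m s k) :=
    fun m s => ⟨u m s, ![t m s, 1], w m s, rfl⟩
  refine ⟨fun m s i j k => u m s i * ![t m s, 1] j * w m s k,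
    fun m => ⟨hel m, hT m⟩, ?_⟩
  rintro m m' hm ⟨σ, hσ⟩
  have h0 := hσ 0
  set s := σ 0
  have hzero : ∀ i k, u m' 0 i * w m' 0 k = 0 := by
    intro i k
    have e0 := congrFun (congrFun (congrFun h0 i) 0) k
    have e1 := congrFun (congrFun (congrFun h0 i) 1) k
    simp only [Matrix.cons_val_zero, Matrix.cons_val_one, mul_one] at e0 e1
    have h2 : (t m' 0 - t m s) * (u m' 0 i * w m' 0 k) = 0 := by
      linear_combination e0 - t m s * e1
    exact (mul_eq_zero.mp h2).resolve_left (sub_ne_zero.mpr (ht m' m s hm.symm))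
  have hle := le_length_of_span_eq_top h (fun q : Fin 2 => hel m' q.succ) (by
    conv_lhs => rw [hT m', Fin.sum_univ_succ]
    rw [add_eq_right]
    funext i j k
    change u m' 0 i * ![t m' 0, 1] j * w m' 0 k = 0
    linear_combination ![t m' 0, 1] j * hzero i k)
  omega

theorem hasInequivalentDecompositions_of_relation {T : Fin 3 → Fin 2 → Fin 2 → ℂ}
    (h : Submodule.span ℂ {x : Fin 3 → ℂ | ∃ j k, x = fun i => T i j k} = ⊤) (b c d : ℂ)
    (hrel : ∀ i, T i 0 0 = b * T i 0 1 + c * T i 1 0 + d * T i 1 1) :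
    HasInequivalentDecompositions T 3 := by
  obtain ⟨e, he⟩ : ∃ e, e = d + b * c := ⟨_, rfl⟩
  obtain rfl : d = e - b * c := by linear_combination -he
  clear he
  by_cases he : e = 0
  · subst he
    refine hasInequivalentDecompositions_of_slopes h
      (fun m => ![fun i => (2 * m + 2) * T i 1 1 - (T i 0 1 - c * T i 1 1),
        fun i => (T i 0 1 - c * T i 1 1) - (2 * m + 1) * T i 1 1,
        fun i => T i 1 0 - b * T i 1 1])
      (fun m => ![c + (2 * m + 1), c + (2 * m + 2), c])
      (fun m => ![![b, 1], ![b, 1], ![1, 0]]) ?_ ?_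
    · intro m
      funext i j k
      fin_cases j <;> fin_cases k <;> simp [Fin.sum_univ_succ, hrel] <;> ring
    · intro m m' s hm
      fin_cases s <;> simp <;> norm_cast <;> omega
  · have hp : ∀ m q : ℕ, ((3 * m + (q + 1) : ℕ) : ℂ) ≠ 0 := fun m q => by
      exact_mod_cast Nat.succ_ne_zero (3 * m + q)
    refine hasInequivalentDecompositions_of_slopes h
      (fun m =>
        let L : ℂ → ℂ → Fin 3 → ℂ := fun p q i =>
          (T i 0 1 - c * T i 1 1) - (p + q) * T i 1 1 + p * q * ((T i 1 0 - b * T i 1 1) / e)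
        ![fun i => (3 * m + 1) * L (3 * m + 2) (3 * m + 3) i / 2,
          fun i => -((3 * m + 2) * L (3 * m + 1) (3 * m + 3) i),
          fun i => (3 * m + 3) * L (3 * m + 1) (3 * m + 2) i / 2])
      (fun m => ![c + (3 * m + 1), c + (3 * m + 2), c + (3 * m + 3)])
      (fun m => ![![b + e / (3 * m + 1), 1], ![b + e / (3 * m + 2), 1],
        ![b + e / (3 * m + 3), 1]]) ?_ ?_
    · intro m
      have h1 := hp m 0
      have h2 := hp m 1
      have h3 := hp m 2
      push_cast at h1 h2 h3
      norm_num at h1 h2 h3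
      funext i j k
      fin_cases j <;> fin_cases k <;> simp [Fin.sum_univ_succ, hrel] <;> field_simp <;> ring
    · intro m m' s hm
      fin_cases s <;> simp <;> norm_cast <;> omega

theorem hasInequivalentDecompositions_of_span_eq_top {T : Fin 3 → Fin 2 → Fin 2 → ℂ}
    (h : Submodule.span ℂ {x : Fin 3 → ℂ | ∃ j k, x = fun i => T i j k} = ⊤) :
    HasInequivalentDecompositions T 3 := by
  have hdep : ¬ LinearIndependent ℂ (fun (p : Fin 2 × Fin 2) i => T i p.1 p.2) := by
    intro hli
    simpa using hli.fintype_card_le_finrank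
  obtain ⟨g, hg, ⟨j, k⟩, hjk⟩ := Fintype.not_linearIndependent_iff.mp hdep
  have hsum : ∀ i, ∑ p : Fin 2 × Fin 2, g p * T i p.1 p.2 = 0 := fun i => by
    simpa [Finset.sum_apply] using congrFun hg i
  let π := Equiv.swap 0 j
  let ρ := Equiv.swap 0 k
  have hspan : Submodule.span ℂ
      {x : Fin 3 → ℂ | ∃ j k, x = fun i => (fun i j k => T i (π j) (ρ k)) i j k} = ⊤ := by
    convert h using 2
    ext x
    constructor
    · rintro ⟨j, k, hx⟩
      exact ⟨π j, ρ k, hx⟩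
    · rintro ⟨j, k, hx⟩
      exact ⟨π.symm j, ρ.symm k, by simpa using hx⟩
  have hne : g (π 0, ρ 0) ≠ 0 := by simpa [π, ρ] using hjk
  refine .of_reindex π ρ (hasInequivalentDecompositions_of_relation hspan
    (-g (π 0, ρ 1) / g (π 0, ρ 0)) (-g (π 1, ρ 0) / g (π 0, ρ 0))
    (-g (π 1, ρ 1) / g (π 0, ρ 0)) fun i => ?_)
  have hs := hsum i
  rw [← (π.prodCongr ρ).sum_comp, Fintype.sum_prod_type] at hs
  simp only [Fin.sum_univ_two, Equiv.prodCongr_apply, Prod.map_apply] at hs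
  field_simp
  linear_combination hs

/-- Every concise tensor in `ℂ³⊗ℂ²⊗ℂ²` is a non-identifiable rank-3 tensor:
it has rank 3 and admits infinitely many pairwise inequivalent decompositions
as sums of 3 elementary tensors. -/
theorem stmt5 (T : Fin 3 → Fin 2 → Fin 2 → ℂ) (hconc : Concise3 T) :
    rank3 T = 3 ∧ ¬ IdentifiableWith3 T 3 ∧
    ∃ D : ℕ → (Fin 3 → (Fin 3 → Fin 2 → Fin 2 → ℂ)),
      (∀ m, (∀ s, Elementary3 (D m s)) ∧ T = ∑ s, D m s) ∧
      ∀ m m', m ≠ m' →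
        ¬ ∃ σ : Equiv.Perm (Fin 3), ∀ s, D m' s = D m (σ s) := by
  obtain ⟨D, hD, hne⟩ := hasInequivalentDecompositions_of_span_eq_top hconc.1
  refine ⟨le_antisymm (Nat.sInf_le ⟨D 0, hD 0⟩) ?_, fun hid => ?_, D, hD, hne⟩
  · refine le_csInf ⟨3, D 0, hD 0⟩ ?_
    rintro r ⟨t, ht, hT⟩
    exact le_length_of_span_eq_top hconc.1 ht hT
  · exact hne 0 1 zero_ne_one (hid _ _ (hD 0).1 (hD 1).1 (hD 0).2 (hD 1).2)
end

section
/- Let T ∈ ℂ²⊗ℂ²⊗ℂ³ be of the form T = v₁⊗v₁⊗u₁ + v₂⊗v₂⊗u₂ + (αv₁+βv₂)⊗(αv₁+βv₂)⊗u₃, where {v₁,v₂} is a basis of ℂ² (used for both the first and second factors), {u₁,u₂,u₃} is a basis of ℂ³, and α ≠ 0, β ≠ 0. Then the matrix pencil of T is strictly equivalent to the pencil λA₀ + μB₀ with A₀ = [[1,0,0],[0,1,0]] and B₀ = [[0,1,0],[0,0,1]] (i.e., to the pencil [[λ,μ,0],[0,λ,μ]]). -/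
open scoped BigOperators

/-- Two matrix pencils `λA + μB` and `λA' + μB'` are strictly equivalent if
`P A Q = A'` and `P B Q = B'` for some invertible `P`, `Q`. -/
def StrictEquiv {m n : ℕ} (A B A' B' : Matrix (Fin m) (Fin n) ℂ) : Prop :=
  ∃ (P : Matrix (Fin m) (Fin m) ℂ) (Q : Matrix (Fin n) (Fin n) ℂ),
    IsUnit P ∧ IsUnit Q ∧ P * A * Q = A' ∧ P * B * Q = B'

/-- If `T ∈ ℂ²⊗ℂ²⊗ℂ³` has the form
`T = v₁⊗v₁⊗u₁ + v₂⊗v₂⊗u₂ + (αv₁+βv₂)⊗(αv₁+βv₂)⊗u₃` with `{v₁,v₂}` a basis of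
`ℂ²` (used for both the first two factors), `{u₁,u₂,u₃}` a basis of `ℂ³` and
`α ≠ 0`, `β ≠ 0`, then the matrix pencil of `T` (slices along the first factor)
is strictly equivalent to `[[λ,μ,0],[0,λ,μ]]`. -/
theorem stmt9 (T : Fin 2 → Fin 2 → Fin 3 → ℂ)
    (v₁ v₂ : Fin 2 → ℂ) (u₁ u₂ u₃ : Fin 3 → ℂ) (α β : ℂ)
    (hv : LinearIndependent ℂ ![v₁, v₂])
    (hu : LinearIndependent ℂ ![u₁, u₂, u₃])
    (hα : α ≠ 0) (hβ : β ≠ 0)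
    (hT : T = fun h i j =>
      v₁ h * v₁ i * u₁ j + v₂ h * v₂ i * u₂ j
        + (α * v₁ h + β * v₂ h) * (α * v₁ i + β * v₂ i) * u₃ j) :
    StrictEquiv (Matrix.of (T 0)) (Matrix.of (T 1))
      !![1,0,0;0,1,0] !![0,1,0;0,0,1] := by
  have hdv : (Matrix.of ![v₁, v₂]).det ≠ 0 :=
    ((Matrix.isUnit_iff_isUnit_det _).1
      (Matrix.linearIndependent_rows_iff_isUnit (A := Matrix.of ![v₁, v₂]).1 hv)).ne_zero
  have hdu : (Matrix.of ![u₁, u₂, u₃]).det ≠ 0 :=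
    ((Matrix.isUnit_iff_isUnit_det _).1
      (Matrix.linearIndependent_rows_iff_isUnit (A := Matrix.of ![u₁, u₂, u₃]).1 hu)).ne_zero
  have hsymm : T 1 0 = T 0 1 := by
    subst hT
    funext j
    ring
  have hdet : (Matrix.of ![T 0 0, T 0 1, T 1 1]).det =
      -(α * β * (Matrix.of ![v₁, v₂]).det ^ 3 * (Matrix.of ![u₁, u₂, u₃]).det) := by
    subst hT
    simp only [Matrix.det_fin_three, Matrix.det_fin_two, Matrix.of_apply, Matrix.cons_val]
    ring
  have hM : IsUnit (Matrix.of ![T 0 0, T 0 1, T 1 1]).det := by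
    rw [hdet, isUnit_iff_ne_zero, neg_ne_zero]
    exact mul_ne_zero (mul_ne_zero (mul_ne_zero hα hβ) (pow_ne_zero 3 hdv)) hdu
  have hA : Matrix.of (T 0) = (!![1,0,0;0,1,0] : Matrix (Fin 2) (Fin 3) ℂ) *
      Matrix.of ![T 0 0, T 0 1, T 1 1] := by
    ext i j
    fin_cases i <;> simp [Matrix.mul_apply, Fin.sum_univ_three]
  have hB : Matrix.of (T 1) = (!![0,1,0;0,0,1] : Matrix (Fin 2) (Fin 3) ℂ) *
      Matrix.of ![T 0 0, T 0 1, T 1 1] := by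
    ext i j
    fin_cases i <;> simp [Matrix.mul_apply, Fin.sum_univ_three, hsymm]
  refine ⟨1, (Matrix.of ![T 0 0, T 0 1, T 1 1])⁻¹, isUnit_one, ?_, ?_, ?_⟩
  · exact (Matrix.isUnit_nonsing_inv_iff).2 ((Matrix.isUnit_iff_isUnit_det _).2 hM)
  · rw [Matrix.one_mul, hA, Matrix.mul_nonsing_inv_cancel_right _ _ hM]
  · rw [Matrix.one_mul, hB, Matrix.mul_nonsing_inv_cancel_right _ _ hM]
end

section
/- Let L, R ⊂ ℂ³ be 2-dimensional linear subspaces and let o ∈ ℂ² be nonzero. Let q' ∈ L⊗R⊗span(o) ⊂ ℂ³⊗ℂ³⊗ℂ² be a tensor of rank 2, and let p = a⊗b⊗c be an elementary tensor with a ∉ L, b ∉ R and c ∉ span(o). Suppose q = q' + p has rank 3. Then every decomposition q = t₁ + t₂ + t₃ into three elementary tensors satisfies, after reordering the summands, t₃ = p, t₁, t₂ ∈ L⊗R⊗span(o), and t₁ + t₂ = q'. -/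
open scoped BigOperators

/-- `S` lies in the subspace `V₁ ⊗ V₂ ⊗ V₃` of `ℂ^a ⊗ ℂ^b ⊗ ℂ^c`:
all slices of `S` along each mode lie in the corresponding subspace. -/
def MemProd {a b c : ℕ} (V₁ : Submodule ℂ (Fin a → ℂ)) (V₂ : Submodule ℂ (Fin b → ℂ))
    (V₃ : Submodule ℂ (Fin c → ℂ)) (S : Fin a → Fin b → Fin c → ℂ) : Prop :=
  (∀ j h, (fun i => S i j h) ∈ V₁) ∧
  (∀ i h, (fun j => S i j h) ∈ V₂) ∧
  (∀ i j, (fun h => S i j h) ∈ V₃)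

open Matrix in
/-- The annihilator of a hyperplane of `ℂ³` is spanned by a vector, normalized on a given
vector off the hyperplane. -/
lemma exists_dotProduct_of_notMem {L : Submodule ℂ (Fin 3 → ℂ)}
    (hL : Module.finrank ℂ L = 2) {a : Fin 3 → ℂ} (ha : a ∉ L) :
    ∃ l : Fin 3 → ℂ, l ⬝ᵥ a = 1 ∧ ∀ x, x ∈ L ↔ l ⬝ᵥ x = 0 := by
  obtain ⟨f, hfa, hf⟩ := Submodule.exists_le_ker_of_notMem ha
  obtain ⟨l, hl⟩ := (dotProductEquiv ℂ (Fin 3)).surjective ((f a)⁻¹ • f)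
  have hlx : ∀ x, l ⬝ᵥ x = (f a)⁻¹ * f x := fun x => by
    simpa using congrArg (fun g : Module.Dual ℂ (Fin 3 → ℂ) => g x) hl
  have hker : L = LinearMap.ker f := by
    apply Submodule.eq_of_le_of_finrank_le hf
    have h1 := Submodule.finrank_lt (s := LinearMap.ker f)
      (fun h => hfa (LinearMap.mem_ker.1 (h ▸ Submodule.mem_top)))
    rw [Module.finrank_fin_fun] at h1
    omega
  refine ⟨l, by rw [hlx, inv_mul_cancel₀ hfa], fun x => ?_⟩
  rw [hlx, hker, LinearMap.mem_ker]
  simp [hfa]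

/-- Coordinates on `ℂ²` with respect to a basis `o, c`. -/
lemma exists_coordinates {o c : Fin 2 → ℂ} (ho : o ≠ 0) (hc : c ∉ Submodule.span ℂ {o}) :
    ∃ f g : (Fin 2 → ℂ) →ₗ[ℂ] ℂ, f o = 1 ∧ f c = 0 ∧ g o = 0 ∧ g c = 1 ∧
      ∀ x, x = f x • o + g x • c := by
  have hli : LinearIndependent ℂ ![o, c] := by
    rw [LinearIndependent.pair_iff' ho]
    exact fun k hk => hc (Submodule.mem_span_singleton.2 ⟨k, hk⟩)
  let B := basisOfLinearIndependentOfCardEqFinrank hli (by simp)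
  have h0 : B 0 = o := by simp [B]
  have h1 : B 1 = c := by simp [B]
  refine ⟨B.coord 0, B.coord 1, ?_, ?_, ?_, ?_, fun x => ?_⟩
  · rw [← h0]; simp
  · rw [← h1]; simp
  · rw [← h0]; simp
  · rw [← h1]; simp
  · have := B.sum_repr x
    rw [Fin.sum_univ_two, h0, h1] at this
    exact this.symm

open Matrix in
/-- A `3 × 3` matrix killing two independent vectors is an outer product. -/
lemma exists_vecMulVec_of_ker {M : Matrix (Fin 3) (Fin 3) ℂ} {x y : Fin 3 → ℂ}
    (hx : M *ᵥ x = 0) (hy : M *ᵥ y = 0) (hxy : LinearIndependent ℂ ![x, y]) :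
    ∃ v w, M = vecMulVec v w := by
  have hker : 2 ≤ Module.finrank ℂ (LinearMap.ker M.mulVecLin) := by
    have hspan : Submodule.span ℂ (Set.range ![x, y]) ≤ LinearMap.ker M.mulVecLin := by
      rw [Submodule.span_le]
      rintro _ ⟨i, rfl⟩
      fin_cases i <;> simp [hx, hy]
    simpa [finrank_span_eq_card hxy] using Submodule.finrank_mono hspan
  have hrn := LinearMap.finrank_range_add_finrank_ker M.mulVecLin
  rw [Module.finrank_fin_fun] at hrn
  obtain ⟨⟨v, _⟩, hv⟩ :=
    finrank_le_one_iff.1 (show Module.finrank ℂ (LinearMap.range M.mulVecLin) ≤ 1 by omega)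
  choose w hw using fun j => hv ⟨_, LinearMap.mem_range_self M.mulVecLin (Pi.single j 1)⟩
  refine ⟨v, w, ?_⟩
  ext i j
  simpa [vecMulVec_apply, mul_comm] using (congrFun (congrArg Subtype.val (hw j)) i).symm

lemma Elementary3.rank3_le_one {a b c : ℕ} {T : Fin a → Fin b → Fin c → ℂ}
    (hT : Elementary3 T) : rank3 T ≤ 1 :=
  Nat.sInf_le ⟨fun _ => T, fun _ => hT, by simp⟩

open Matrix in
/-- If `M ∈ L ⊗ R` is not an outer product and `a ∉ L`, `b ∉ R`, then `M + a ⊗ b` is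
invertible. Here `L` and `R` are the hyperplanes orthogonal to `l` and `r`. -/
lemma det_add_vecMulVec_ne_zero {M : Matrix (Fin 3) (Fin 3) ℂ} {a b l r : Fin 3 → ℂ}
    (hla : l ⬝ᵥ a = 1) (hrb : r ⬝ᵥ b = 1) (hl : l ᵥ* M = 0) (hr : M *ᵥ r = 0)
    (hM : ∀ v w, M ≠ vecMulVec v w) : (M + vecMulVec a b).det ≠ 0 := by
  intro hdet
  obtain ⟨x, hx0, hx⟩ := exists_mulVec_eq_zero_iff.2 hdet
  have hbx : b ⬝ᵥ x = 0 := by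
    have h := congrArg (fun y => l ⬝ᵥ y) hx
    simpa [add_mulVec, dotProduct_add, dotProduct_mulVec, hl, vecMulVec_mulVec, hla,
      vecMul_vecMulVec, vecMul_add] using h
  have hMx : M *ᵥ x = 0 := by
    simpa [add_mulVec, vecMulVec_mulVec, hbx] using hx
  have hli : LinearIndependent ℂ ![x, r] := by
    rw [LinearIndependent.pair_iff' hx0]
    rintro k rfl
    simp [dotProduct_comm x b, hbx] at hrb
  obtain ⟨v, w, h⟩ := exists_vecMulVec_of_ker hMx hr hli
  exact hM v w h

open Matrix in
/-- If `U * diagonal d * V` is an outer product `a ⊗ b` with `a ≠ 0` and `U`, `V` are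
invertible, then `d` has at most one nonzero entry. -/
lemma exists_forall_ne_eq_zero_of_vecMulVec_eq {n : Type*} [Fintype n] [DecidableEq n]
    {U V : Matrix n n ℂ} {d a b : n → ℂ} (hU : IsUnit U.det) (hV : IsUnit V.det)
    (h : vecMulVec a b = U * diagonal d * V) (ha : a ≠ 0) :
    ∃ s, ∀ t, t ≠ s → d t = 0 := by
  have hd : diagonal d = vecMulVec (U⁻¹ *ᵥ a) (b ᵥ* V⁻¹) := by
    rw [← vecMulVec_mul, ← mul_vecMulVec, h]
    rw [Matrix.mul_assoc U, nonsing_inv_mul_cancel_left _ _ hU, mul_nonsing_inv_cancel_right _ _ hV]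
  have hα : U⁻¹ *ᵥ a ≠ 0 := fun h0 => ha <| by
    have := congrArg (U *ᵥ ·) h0
    simpa [mulVec_mulVec, mul_nonsing_inv _ hU] using this
  obtain ⟨s, hs⟩ := Function.ne_iff.1 hα
  refine ⟨s, fun t ht => ?_⟩
  have hst := congrFun (congrFun hd s) t
  rw [diagonal_apply_ne _ ht.symm, vecMulVec_apply, eq_comm] at hst
  have htt := congrFun (congrFun hd t) t
  rw [diagonal_apply_eq, vecMulVec_apply, (mul_eq_zero.1 hst).resolve_left hs, mul_zero] at htt
  exact htt

open Matrix in
lemma of_mul_diagonal_mul_of_apply (u v : Fin 3 → Fin 3 → ℂ) (d : Fin 3 → ℂ) (i j : Fin 3) :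
    ((of u)ᵀ * diagonal d * of v) i j = ∑ s, u s i * v s j * d s := by
  rw [Matrix.mul_apply]
  simp [mul_diagonal, mul_right_comm]

lemma MemProd.of_mul {a b c : ℕ} {V₁ : Submodule ℂ (Fin a → ℂ)} {V₂ : Submodule ℂ (Fin b → ℂ)}
    {V₃ : Submodule ℂ (Fin c → ℂ)} {u : Fin a → ℂ} {v : Fin b → ℂ} {w : Fin c → ℂ}
    (hu : u ∈ V₁) (hv : v ∈ V₂) (hw : w ∈ V₃) :
    MemProd V₁ V₂ V₃ (fun i j h => u i * v j * w h) := by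
  refine ⟨fun j h => ?_, fun i h => ?_, fun i j => V₃.smul_mem (u i * v j) hw⟩
  · convert V₁.smul_mem (v j * w h) hu using 1
    ext; simp; ring
  · convert V₂.smul_mem (u i * w h) hv using 1
    ext; simp; ring

open Matrix in
/-- A tensor in `L ⊗ R ⊗ ⟨o⟩` is a matrix with columns in `L` and rows in `R`, times `o`. -/
lemma MemProd.exists_matrix {a b c : ℕ} {L : Submodule ℂ (Fin a → ℂ)}
    {R : Submodule ℂ (Fin b → ℂ)} {o : Fin c → ℂ} (ho : o ≠ 0)
    {T : Fin a → Fin b → Fin c → ℂ} (hT : MemProd L R (Submodule.span ℂ {o}) T) :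
    ∃ M : Matrix (Fin a) (Fin b) ℂ, (∀ i j, T i j = M i j • o) ∧
      (∀ j, (fun i => M i j) ∈ L) ∧ ∀ i, M i ∈ R := by
  obtain ⟨h1, h2, h3⟩ := hT
  choose M hM using fun i j => Submodule.mem_span_singleton.1 (h3 i j)
  obtain ⟨h, hh⟩ := Function.ne_iff.1 ho
  have hMh : ∀ i j, M i j = (o h)⁻¹ * T i j h := fun i j => by
    have := congrFun (hM i j) h
    simp only [Pi.smul_apply, smul_eq_mul] at this
    rw [← this, mul_comm (M i j), inv_mul_cancel_left₀ hh]
  refine ⟨M, fun i j => (hM i j).symm, fun j => ?_, fun i => ?_⟩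
  · simp only [hMh]
    exact L.smul_mem (o h)⁻¹ (h1 j h)
  · have : M i = (o h)⁻¹ • fun j => T i j h := funext (hMh i)
    exact this ▸ R.smul_mem (o h)⁻¹ (h2 i h)

open Matrix in
/-- Let `L, R ⊂ ℂ³` be 2-dimensional subspaces, `o ∈ ℂ²` nonzero, `q' ∈ L⊗R⊗⟨o⟩`
of rank 2, and `p = a⊗b⊗c` elementary with `a ∉ L`, `b ∉ R`, `c ∉ ⟨o⟩`. If
`q = q' + p` has rank 3, then every decomposition of `q` as a sum of three
elementary tensors is, after reordering, `p` together with a decomposition of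
`q'` inside `L⊗R⊗⟨o⟩`. -/
theorem stmt12 (L R : Submodule ℂ (Fin 3 → ℂ))
    (hL : Module.finrank ℂ L = 2) (hR : Module.finrank ℂ R = 2)
    (o : Fin 2 → ℂ) (ho : o ≠ 0)
    (q' : Fin 3 → Fin 3 → Fin 2 → ℂ)
    (hq'mem : MemProd L R (Submodule.span ℂ {o}) q')
    (hq'rk : rank3 q' = 2)
    (a b : Fin 3 → ℂ) (c : Fin 2 → ℂ)
    (ha : a ∉ L) (hb : b ∉ R) (hc : c ∉ Submodule.span ℂ {o})
    (p : Fin 3 → Fin 3 → Fin 2 → ℂ)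
    (hp : p = fun i j h => a i * b j * c h)
    (hqrk : rank3 (q' + p) = 3) :
    ∀ t : Fin 3 → (Fin 3 → Fin 3 → Fin 2 → ℂ),
      (∀ s, Elementary3 (t s)) → q' + p = ∑ s, t s →
      ∃ σ : Equiv.Perm (Fin 3),
        t (σ 2) = p ∧
        MemProd L R (Submodule.span ℂ {o}) (t (σ 0)) ∧
        MemProd L R (Submodule.span ℂ {o}) (t (σ 1)) ∧
        t (σ 0) + t (σ 1) = q' := by
  intro t ht hsum
  obtain ⟨l, hla, hlL⟩ := exists_dotProduct_of_notMem hL ha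
  obtain ⟨r, hrb, hrR⟩ := exists_dotProduct_of_notMem hR hb
  obtain ⟨f, g, hfo, hfc, hgo, hgc, hfg⟩ := exists_coordinates ho hc
  obtain ⟨M, hq', hML, hMR⟩ := hq'mem.exists_matrix ho
  choose u v w hw using ht
  have hlM : l ᵥ* M = 0 := funext fun j => (hlL _).1 (hML j)
  have hMr : M *ᵥ r = 0 := funext fun i => by
    simpa [Matrix.mulVec, dotProduct_comm] using (hrR _).1 (hMR i)
  have hr0 : r ≠ 0 := by rintro rfl; simp at hrb
  have ha0 : a ≠ 0 := by rintro rfl; simp at hla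
  have hdetM : M.det = 0 := exists_mulVec_eq_zero_iff.1 ⟨r, hr0, hMr⟩
  have hdet : (M + vecMulVec a b).det ≠ 0 := by
    refine det_add_vecMulVec_ne_zero hla hrb hlM hMr fun x y hxy => ?_
    have hle : rank3 q' ≤ 1 := Elementary3.rank3_le_one ⟨x, y, o, by
      ext i j h
      simp [hq', hxy, vecMulVec_apply]⟩
    omega
  have hslice : ∀ i j, M i j • o + (a i * b j) • c = ∑ s, (u s i * v s j) • w s := fun i j => by
    ext h
    have := congrFun (congrFun (congrFun hsum i) j) h
    simpa [hp, hq', hw, Finset.sum_apply] using this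
  let U : Matrix (Fin 3) (Fin 3) ℂ := (of u)ᵀ
  let V : Matrix (Fin 3) (Fin 3) ℂ := of v
  have hM : M = U * diagonal (fun s => f (w s)) * V := by
    ext i j
    rw [of_mul_diagonal_mul_of_apply]
    simpa [hfo, hfc] using congrArg f (hslice i j)
  have hA : vecMulVec a b = U * diagonal (fun s => g (w s)) * V := by
    ext i j
    rw [of_mul_diagonal_mul_of_apply, vecMulVec_apply]
    simpa [hgo, hgc] using congrArg g (hslice i j)
  have hN : M + vecMulVec a b = U * diagonal (fun s => f (w s) + g (w s)) * V := by
    rw [hM, hA, ← Matrix.add_mul, ← Matrix.mul_add, diagonal_add]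
  rw [hN, det_mul, det_mul, det_diagonal, mul_ne_zero_iff, mul_ne_zero_iff,
    Finset.prod_ne_zero_iff] at hdet
  obtain ⟨⟨hU, hd⟩, hV⟩ := hdet
  obtain ⟨s, hs⟩ :=
    exists_forall_ne_eq_zero_of_vecMulVec_eq hU.isUnit hV.isUnit hA ha0
  have hfne : ∀ k, k ≠ s → f (w k) ≠ 0 := fun k hk => by
    simpa [hs k hk] using hd k (Finset.mem_univ k)
  have hfs : f (w s) = 0 := by
    rw [hM, det_mul, det_mul, det_diagonal] at hdetM
    obtain ⟨k, -, hk⟩ := Finset.prod_eq_zero_iff.1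
      (((mul_eq_zero.1 hdetM).resolve_right hV |> mul_eq_zero.1).resolve_left hU)
    by_cases hks : k = s
    · exact hks ▸ hk
    · exact absurd hk (hfne k hks)
  have hts : t s = p := by
    ext i j h
    have hab : a i * b j = u s i * v s j * g (w s) := by
      rw [← vecMulVec_apply, hA, of_mul_diagonal_mul_of_apply]
      exact Finset.sum_eq_single s (fun k _ hk => by simp [hs k hk]) (by simp)
    have hws : w s h = g (w s) * c h := by
      simpa [hfs] using congrFun (hfg (w s)) h
    rw [hw, hp]
    simp only
    rw [hws, hab, mul_assoc _ (g (w s))]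
  have hu : ∀ k, k ≠ s → u k ∈ L := fun k hk => by
    have h : (l ᵥ* (U * diagonal fun s => f (w s))) ᵥ* V = 0 := by
      rw [vecMul_vecMul, ← hM, hlM]
    have h := congrFun (eq_zero_of_vecMul_eq_zero hV h) k
    rw [← vecMul_vecMul, vecMul_diagonal] at h
    exact (hlL _).2 ((mul_eq_zero.1 h).resolve_right (hfne k hk))
  have hv : ∀ k, k ≠ s → v k ∈ R := fun k hk => by
    have h : U *ᵥ (diagonal (fun s => f (w s)) *ᵥ (V *ᵥ r)) = 0 := by
      rw [mulVec_mulVec, mulVec_mulVec, ← hM, hMr]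
    have h := congrFun (eq_zero_of_mulVec_eq_zero hU h) k
    rw [mulVec_diagonal] at h
    rw [hrR, dotProduct_comm]
    exact (mul_eq_zero.1 h).resolve_left (hfne k hk)
  have hmem : ∀ k, k ≠ s → MemProd L R (Submodule.span ℂ {o}) (t k) := fun k hk => by
    rw [hw]
    refine MemProd.of_mul (hu k hk) (hv k hk) (Submodule.mem_span_singleton.2 ⟨f (w k), ?_⟩)
    simpa [hs k hk] using (hfg (w k)).symm
  have hσ : Equiv.swap s 2 2 = s := Equiv.swap_apply_right s 2
  have hne : ∀ k : Fin 3, k ≠ 2 → Equiv.swap s 2 k ≠ s := fun k hk h =>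
    hk ((Equiv.swap s 2).injective (h.trans hσ.symm))
  refine ⟨Equiv.swap s 2, by rw [hσ, hts], hmem _ (hne 0 (by decide)),
    hmem _ (hne 1 (by decide)), ?_⟩
  rw [← Equiv.sum_comp (Equiv.swap s 2), Fin.sum_univ_three, hσ, hts] at hsum
  exact (add_right_cancel hsum).symm
end

section
/- Let k ≥ 4, n₁, n₂ ∈ {2,3}, and (n₁,n₂,k) ≠ (2,2,4). Let T ∈ ℂ^{n₁}⊗ℂ^{n₂}⊗(ℂ²)^{⊗(k−2)} be concise. Then T can be written as T = (a₁⊗b₁ + a₂⊗b₂)⊗u₃⊗⋯⊗u_k + a₃⊗b₃⊗ũ₃⊗⋯⊗ũ_k with a₁,a₂ ∈ ℂ^{n₁} linearly independent, b₁,b₂ ∈ ℂ^{n₂} linearly independent, a₃,b₃ nonzero, and {uᵢ,ũᵢ} linearly independent in ℂ² for every i = 3,…,k, if and only if there exist X, Y ∈ ℂ^{n₁}⊗ℂ^{n₂} linearly independent and vectors uᵢ, vᵢ ∈ ℂ² with {uᵢ,vᵢ} linearly independent for every i = 3,…,k such that T = X⊗u₃⊗⋯⊗u_k + Y⊗v₃⊗⋯⊗v_k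 (where X and Y occupy the first two factors) and, viewing X and Y as n₁×n₂ matrices, {rank X, rank Y} = {1, 2}. -/
open scoped BigOperators

/-- A coordinate tensor in `ℂ^{n₁} ⊗ ℂ^{n₂} ⊗ (ℂ²)^{⊗ r}` is elementary if it is
`a ⊗ b ⊗ w₁ ⊗ ⋯ ⊗ w_r` for vectors `a, b` and `w l ∈ ℂ²`. -/
def ElementaryK {n₁ n₂ r : ℕ} (T : Fin n₁ → Fin n₂ → (Fin r → Fin 2) → ℂ) : Prop :=
  ∃ (a : Fin n₁ → ℂ) (b : Fin n₂ → ℂ) (w : Fin r → Fin 2 → ℂ),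
    T = fun i j f => a i * b j * ∏ l, w l (f l)

/-- A tensor is concise if every one of its flattenings has maximal rank. -/
def ConciseK {n₁ n₂ r : ℕ} (T : Fin n₁ → Fin n₂ → (Fin r → Fin 2) → ℂ) : Prop :=
  Submodule.span ℂ {x : Fin n₁ → ℂ | ∃ j f, x = fun i => T i j f} = ⊤ ∧
  Submodule.span ℂ {x : Fin n₂ → ℂ | ∃ i f, x = fun j => T i j f} = ⊤ ∧
  ∀ l : Fin r, Submodule.span ℂ
    {x : Fin 2 → ℂ | ∃ i j f, x = fun d => T i j (Function.update f l d)} = ⊤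

/-- The product `Aᵀ * B` of matrices with `r` linearly independent rows each has rank `r`. -/
theorem Matrix.rank_transpose_mul_of_linearIndependent_row {K : Type*} [Field K] {r m n : ℕ}
    {A : Matrix (Fin r) (Fin m) K} {B : Matrix (Fin r) (Fin n) K}
    (hA : LinearIndependent K A.row) (hB : LinearIndependent K B.row) :
    (A.transpose * B).rank = r := by
  have hB' : LinearMap.range B.mulVecLin = ⊤ := by
    apply Submodule.eq_top_of_finrank_eq
    have := hB.rank_matrix
    rw [Matrix.rank] at this
    simpa using this
  rw [Matrix.rank, Matrix.mulVecLin_mul, LinearMap.range_comp_of_range_eq_top _ hB',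
    ← Matrix.rank, Matrix.rank_transpose, hA.rank_matrix, Fintype.card_fin]

/-- A matrix with `r` rows and rank `r` has linearly independent rows. -/
theorem Matrix.linearIndependent_row_of_rank_eq {K : Type*} [Field K] {r n : ℕ}
    {A : Matrix (Fin r) (Fin n) K} (h : r ≤ A.rank) : LinearIndependent K A.row := by
  rw [linearIndependent_iff_card_le_finrank_span, Fintype.card_fin]
  rwa [Matrix.rank_eq_finrank_span_row] at h

/-- Rank factorization. -/
theorem Matrix.exists_eq_transpose_mul_of_rank_eq {K : Type*} [Field K] {r m n : ℕ}
    {M : Matrix (Fin m) (Fin n) K} (h : M.rank = r) :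
    ∃ (A : Matrix (Fin r) (Fin m) K) (B : Matrix (Fin r) (Fin n) K),
      LinearIndependent K A.row ∧ LinearIndependent K B.row ∧ M = A.transpose * B := by
  let e := Module.finBasisOfFinrankEq K (LinearMap.range M.mulVecLin) h
  let A : Matrix (Fin r) (Fin m) K := fun s i => (e s : Fin m → K) i
  let B : Matrix (Fin r) (Fin n) K := fun s j =>
    e.repr (M.mulVecLin.rangeRestrict (Pi.single j 1)) s
  have hM : M = A.transpose * B := by
    ext i j
    have := congrArg (fun x : LinearMap.range M.mulVecLin => (x : Fin m → K) i)
      (e.sum_repr (M.mulVecLin.rangeRestrict (Pi.single j 1)))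
    simp only [Submodule.coe_sum, Submodule.coe_smul, Finset.sum_apply, Pi.smul_apply,
      smul_eq_mul, LinearMap.codRestrict_apply, LinearMap.rangeRestrict,
      Matrix.mulVecLin_apply, Matrix.mulVec_single_one, Matrix.col_apply] at this
    rw [← this, Matrix.mul_apply]
    exact Finset.sum_congr rfl fun s _ => mul_comm _ _
  refine ⟨A, B, Matrix.linearIndependent_row_of_rank_eq ?_,
    Matrix.linearIndependent_row_of_rank_eq ?_, hM⟩
  · rw [← Matrix.rank_transpose A]
    exact h.symm.le.trans (hM ▸ Matrix.rank_mul_le_left A.transpose B)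
  · exact h.symm.le.trans (hM ▸ Matrix.rank_mul_le_right A.transpose B)

/-- A matrix has rank one iff it is the outer product of two nonzero vectors. -/
theorem Matrix.rank_eq_one_iff_exists {K : Type*} [Field K] {m n : ℕ}
    {M : Matrix (Fin m) (Fin n) K} :
    M.rank = 1 ↔ ∃ (a : Fin m → K) (b : Fin n → K), a ≠ 0 ∧ b ≠ 0 ∧
      M = fun i j => a i * b j := by
  constructor
  · intro h
    obtain ⟨A, B, hA, hB, rfl⟩ := Matrix.exists_eq_transpose_mul_of_rank_eq h
    refine ⟨A 0, B 0, hA.ne_zero 0, hB.ne_zero 0, ?_⟩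
    ext i j
    simp [Matrix.mul_apply]
  · rintro ⟨a, b, ha, hb, rfl⟩
    refine (congrArg Matrix.rank ?_).trans
      (Matrix.rank_transpose_mul_of_linearIndependent_row (A := Matrix.of ![a]) (B := Matrix.of ![b])
        (linearIndependent_unique_iff.2 ha) (linearIndependent_unique_iff.2 hb))
    ext i j
    simp [Matrix.mul_apply]

/-- A matrix has rank two iff it is a sum of two outer products of linearly independent pairs. -/
theorem Matrix.rank_eq_two_iff_exists {K : Type*} [Field K] {m n : ℕ}
    {M : Matrix (Fin m) (Fin n) K} :
    M.rank = 2 ↔ ∃ (a₁ a₂ : Fin m → K) (b₁ b₂ : Fin n → K),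
      LinearIndependent K ![a₁, a₂] ∧ LinearIndependent K ![b₁, b₂] ∧
      M = fun i j => a₁ i * b₁ j + a₂ i * b₂ j := by
  constructor
  · intro h
    obtain ⟨A, B, hA, hB, rfl⟩ := Matrix.exists_eq_transpose_mul_of_rank_eq h
    refine ⟨A 0, A 1, B 0, B 1, ?_, ?_, ?_⟩
    · convert hA using 1
      ext s : 1
      fin_cases s <;> rfl
    · convert hB using 1
      ext s : 1
      fin_cases s <;> rfl
    · ext i j
      simp [Matrix.mul_apply, Fin.sum_univ_two]
  · rintro ⟨a₁, a₂, b₁, b₂, ha, hb, rfl⟩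
    refine (congrArg Matrix.rank ?_).trans
      (Matrix.rank_transpose_mul_of_linearIndependent_row (A := Matrix.of ![a₁, a₂]) (B := Matrix.of ![b₁, b₂])
        ha hb)
    ext i j
    simp [Matrix.mul_apply, Fin.sum_univ_two]

/-- Nonzero matrices of different ranks are linearly independent. -/
theorem Matrix.linearIndependent_pair_of_rank_ne {K : Type*} [Field K] {m n : ℕ}
    {X Y : Matrix (Fin m) (Fin n) K} (hX : X.rank ≠ 0) (hY : Y.rank ≠ 0)
    (h : X.rank ≠ Y.rank) : LinearIndependent K ![X, Y] := by
  rw [LinearIndependent.pair_iff' (by rintro rfl; exact hX Matrix.rank_zero)]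
  rintro c rfl
  have hc : c ≠ 0 := by
    rintro rfl
    simp at hY
  exact h (Matrix.rank_smul_of_mem_nonZeroDivisors X (mem_nonZeroDivisors_of_ne_zero hc)).symm

/-- Criterion for membership in the general family of non-identifiable rank-3
tensors, via the reshape grouping the first two factors: a concise tensor
`T ∈ ℂ^{n₁}⊗ℂ^{n₂}⊗(ℂ²)^{⊗(k-2)}` (with `k ≥ 4`, `n₁,n₂ ∈ {2,3}`,
`(n₁,n₂,k) ≠ (2,2,4)`) has the form
`(a₁⊗b₁+a₂⊗b₂)⊗u₃⊗⋯⊗u_k + a₃⊗b₃⊗ũ₃⊗⋯⊗ũ_k` iff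
`T = X⊗u₃⊗⋯⊗u_k + Y⊗v₃⊗⋯⊗v_k` with `X, Y` linearly independent matrices of
ranks `{1,2}` and each `{uᵢ,vᵢ}` linearly independent. -/
theorem stmt14 (k n₁ n₂ : ℕ) (hk : 4 ≤ k)
    (hn₁ : n₁ = 2 ∨ n₁ = 3) (hn₂ : n₂ = 2 ∨ n₂ = 3)
    (hne : ¬(n₁ = 2 ∧ n₂ = 2 ∧ k = 4))
    (T : Fin n₁ → Fin n₂ → (Fin (k - 2) → Fin 2) → ℂ)
    (hconc : ConciseK T) :
    (∃ (a₁ a₂ a₃ : Fin n₁ → ℂ) (b₁ b₂ b₃ : Fin n₂ → ℂ)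
       (u u' : Fin (k - 2) → Fin 2 → ℂ),
      LinearIndependent ℂ ![a₁, a₂] ∧
      LinearIndependent ℂ ![b₁, b₂] ∧
      a₃ ≠ 0 ∧ b₃ ≠ 0 ∧
      (∀ l, LinearIndependent ℂ ![u l, u' l]) ∧
      T = fun i j f =>
        (a₁ i * b₁ j + a₂ i * b₂ j) * ∏ l, u l (f l)
          + a₃ i * b₃ j * ∏ l, u' l (f l)) ↔
    (∃ (X Y : Matrix (Fin n₁) (Fin n₂) ℂ) (u v : Fin (k - 2) → Fin 2 → ℂ),
      LinearIndependent ℂ ![X, Y] ∧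
      (∀ l, LinearIndependent ℂ ![u l, v l]) ∧
      (T = fun i j f => X i j * ∏ l, u l (f l) + Y i j * ∏ l, v l (f l)) ∧
      ((X.rank = 1 ∧ Y.rank = 2) ∨ (X.rank = 2 ∧ Y.rank = 1))) := by
  constructor
  · rintro ⟨a₁, a₂, a₃, b₁, b₂, b₃, u, u', ha, hb, ha₃, hb₃, hu, hT⟩
    have hX := Matrix.rank_eq_two_iff_exists.2 ⟨a₁, a₂, b₁, b₂, ha, hb, rfl⟩
    have hY := Matrix.rank_eq_one_iff_exists.2 ⟨a₃, b₃, ha₃, hb₃, rfl⟩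
    exact ⟨_, _, u, u', Matrix.linearIndependent_pair_of_rank_ne (by simp [hX]) (by simp [hY])
      (by simp [hX, hY]), hu, hT, Or.inr ⟨hX, hY⟩⟩
  · rintro ⟨X, Y, u, v, -, huv, hT, ⟨hX, hY⟩ | ⟨hX, hY⟩⟩
    · obtain ⟨a₃, b₃, ha₃, hb₃, rfl⟩ := Matrix.rank_eq_one_iff_exists.1 hX
      obtain ⟨a₁, a₂, b₁, b₂, ha, hb, rfl⟩ := Matrix.rank_eq_two_iff_exists.1 hY
      refine ⟨a₁, a₂, a₃, b₁, b₂, b₃, v, u, ha, hb, ha₃, hb₃,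
        fun l => LinearIndependent.pair_symm_iff.1 (huv l), ?_⟩
      rw [hT]
      funext i j f
      exact add_comm _ _
    · obtain ⟨a₁, a₂, b₁, b₂, ha, hb, rfl⟩ := Matrix.rank_eq_two_iff_exists.1 hX
      obtain ⟨a₃, b₃, ha₃, hb₃, rfl⟩ := Matrix.rank_eq_one_iff_exists.1 hY
      exact ⟨a₁, a₂, a₃, b₁, b₂, b₃, u, v, ha, hb, ha₃, hb₃, huv, hT⟩
end

section
/- Let q ∈ ℂ³⊗ℂ²⊗ℂ² be a concise tensor of rank 3, fix a decomposition q = a₁⊗b₁⊗c₁ + a₂⊗b₂⊗c₂ + a₃⊗b₃⊗c₃ into elementary tensors, and let φ : ℂ²×ℂ² → ℂ be a nonzero bilinear form with φ(bᵢ,cᵢ) = 0 for i = 1,2,3 (such φ exists since bilinear forms on ℂ²×ℂ² form a 4-dimensional space). Then every decomposition q = a'₁⊗b'₁⊗c'₁ + a'₂⊗b'₂⊗c'₂ + a'₃⊗b'₃⊗c'₃ into three elementary tensors satisfies φ(b'ⱼ,c'ⱼ) = 0 for j = 1,2,3. -/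
open scoped BigOperators

/-- A bilinear form on coordinate spaces, in terms of its values on the standard basis. -/
lemma bilin_apply_eq_sum {m n : ℕ} (φ : (Fin m → ℂ) →ₗ[ℂ] (Fin n → ℂ) →ₗ[ℂ] ℂ)
    (v : Fin m → ℂ) (w : Fin n → ℂ) :
    φ v w = ∑ j, ∑ k, v j * w k * φ (Pi.single j 1) (Pi.single k 1) := by
  conv_lhs => rw [pi_eq_sum_univ' v, pi_eq_sum_univ' w]
  simp only [map_sum, map_smul, LinearMap.sum_apply, LinearMap.smul_apply, smul_eq_mul,
    Finset.mul_sum, mul_assoc]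
  exact Finset.sum_comm.trans (by simp [mul_left_comm])

/-- Contracting the last two factors of `∑ uₛ⊗vₛ⊗wₛ` with a bilinear form `φ` gives
`∑ φ(vₛ, wₛ) uₛ`. -/
lemma contract_sum_elementary {l m n r : ℕ} (φ : (Fin m → ℂ) →ₗ[ℂ] (Fin n → ℂ) →ₗ[ℂ] ℂ)
    (u : Fin r → Fin l → ℂ) (v : Fin r → Fin m → ℂ) (w : Fin r → Fin n → ℂ) (i : Fin l) :
    ∑ j, ∑ k, (∑ s, u s i * v s j * w s k) * φ (Pi.single j 1) (Pi.single k 1) =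
      ∑ s, φ (v s) (w s) * u s i := by
  simp only [bilin_apply_eq_sum φ (v _) (w _), Finset.sum_mul]
  rw [Finset.sum_congr rfl fun j _ => Finset.sum_comm, Finset.sum_comm]
  refine Finset.sum_congr rfl fun s _ => Finset.sum_congr rfl fun j _ =>
    Finset.sum_congr rfl fun k _ => by ring

/-- If the slices of `∑ uₛ⊗vₛ⊗wₛ` in the first direction span `ℂ^r`, where `r` is the number of
summands, then the `uₛ` are linearly independent. -/
lemma linearIndependent_of_span_slices {m n r : ℕ}
    (u : Fin r → Fin r → ℂ) (v : Fin r → Fin m → ℂ) (w : Fin r → Fin n → ℂ)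
    (h : Submodule.span ℂ {x : Fin r → ℂ | ∃ j k, x = fun i => ∑ s, u s i * v s j * w s k} = ⊤) :
    LinearIndependent ℂ u := by
  refine linearIndependent_of_top_le_span_of_card_eq_finrank ?_ (by simp)
  rw [← h, Submodule.span_le]
  rintro _ ⟨j, k, rfl⟩
  have : (fun i => ∑ s, u s i * v s j * w s k) = ∑ s, (v s j * w s k) • u s := by
    ext i
    simp [Finset.sum_apply, mul_comm, mul_left_comm]
  rw [this]
  exact Submodule.sum_mem _ fun s _ =>
    Submodule.smul_mem _ _ (Submodule.subset_span (Set.mem_range_self s))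

/-- Let `q ∈ ℂ³⊗ℂ²⊗ℂ²` be concise of rank 3 with a fixed decomposition
`q = ∑ aₛ⊗bₛ⊗cₛ`, and let `φ` be a nonzero bilinear form on `ℂ²×ℂ²` vanishing
on all pairs `(bₛ, cₛ)`. Then for every decomposition of `q` as a sum of three
elementary tensors `a'⊗b'⊗c'`, the form `φ` vanishes on every pair `(b', c')`. -/
theorem stmt15 (q : Fin 3 → Fin 2 → Fin 2 → ℂ)
    (hconc : Concise3 q) (hrk : rank3 q = 3)
    (a : Fin 3 → Fin 3 → ℂ) (b c : Fin 3 → Fin 2 → ℂ)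
    (hdec : q = fun i j h => ∑ s : Fin 3, a s i * b s j * c s h)
    (φ : (Fin 2 → ℂ) →ₗ[ℂ] (Fin 2 → ℂ) →ₗ[ℂ] ℂ) (hφ : φ ≠ 0)
    (hφ0 : ∀ s, φ (b s) (c s) = 0) :
    ∀ t : Fin 3 → (Fin 3 → Fin 2 → Fin 2 → ℂ),
      (∀ s, Elementary3 (t s)) → q = ∑ s, t s →
      ∀ (s : Fin 3) (a' : Fin 3 → ℂ) (b' c' : Fin 2 → ℂ),
        t s = (fun i j h => a' i * b' j * c' h) → φ b' c' = 0 := by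
  intro t ht hq s a' b' c' hs
  have hex : ∀ r, ∃ (u : Fin 3 → ℂ) (v w : Fin 2 → ℂ),
      t r = (fun i j k => u i * v j * w k) ∧ (r = s → v = b' ∧ w = c') := by
    intro r
    by_cases hr : r = s
    · exact ⟨a', b', c', hr ▸ hs, fun _ => ⟨rfl, rfl⟩⟩
    · obtain ⟨u, v, w, h⟩ := ht r
      exact ⟨u, v, w, h, fun h' => absurd h' hr⟩
  choose u v w ht' hs' using hex
  have hq' : q = fun i j k => ∑ r, u r i * v r j * w r k := by
    rw [hq]
    ext i j k
    simp [Finset.sum_apply, ht']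
  have hli : LinearIndependent ℂ u := by
    refine linearIndependent_of_span_slices u v w ?_
    have h := hconc.1
    rwa [hq'] at h
  have hsum : ∑ r, φ (v r) (w r) • u r = 0 := by
    ext i
    have h := contract_sum_elementary φ u v w i
    have h' := contract_sum_elementary φ a b c i
    have e : ∀ j k, ∑ r, u r i * v r j * w r k = ∑ r, a r i * b r j * c r k := fun j k =>
      congrFun (congrFun (congrFun (hq'.symm.trans hdec) i) j) k
    simp only [e, h', hφ0, zero_mul, Finset.sum_const_zero] at h
    simpa only [Finset.sum_apply, Pi.smul_apply, smul_eq_mul, Pi.zero_apply] using h.symm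
  have h := Fintype.linearIndependent_iff.mp hli _ hsum s
  rwa [(hs' s rfl).1, (hs' s rfl).2] at h
end
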